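/- For the fixed-penalty matching distance d_{M,ρ}, if ρ ≥ (1/2)·max_{x∈X, y∈Y} d(x,y), then there exists a complete matching (one of size min(|X|,|Y|)) achieving the minimum defining d_{M,ρ}(X,Y). -/

import Mathlib

/-- `M` is a matching of the multisets `A` and `B`: a multiset of pairs `(x, y)` with
`x ∈ A`, `y ∈ B`, using each element of `A` and of `B` at most once, counting
multiplicity. -/
def IsMatching {α : Type*} (A B : Multiset α) (M : Multiset (α × α)) : Prop :=
  M.map Prod.fst ≤ A ∧ M.map Prod.snd ≤ B

/-- Cost of a matching `M` for the fixed-penalty matching distance: sum of pairwise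
distances of matched elements plus `ρ` for each unmatched element. -/
noncomputable def fpMatchingCost {α : Type*} [MetricSpace α] (ρ : ℝ)
    (A B : Multiset α) (M : Multiset (α × α)) : ℝ :=
  (M.map fun p => dist p.1 p.2).sum
    + ρ * ((A.card : ℝ) + (B.card : ℝ) - 2 * (M.card : ℝ))

/-- The fixed-penalty matching distance `d_{M,ρ}`: minimal cost over all matchings. -/
noncomputable def dFPMatch {α : Type*} [MetricSpace α] (ρ : ℝ) (A B : Multiset α) : ℝ :=
  sInf {c | ∃ M, IsMatching A B M ∧ c = fpMatchingCost ρ A B M}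

theorem isMatching_finite {α : Type*} (A B : Multiset α) : {M | IsMatching A B M}.Finite := by
  classical
  refine (Set.finite_Iic (A.card • (A ×ˢ B))).subset ?_
  rintro M ⟨h1, h2⟩
  rw [Set.mem_Iic, Multiset.le_iff_count]
  intro p
  by_cases hp : p ∈ M
  · have hA : p.1 ∈ A := Multiset.mem_of_le h1 (Multiset.mem_map_of_mem _ hp)
    have hB : p.2 ∈ B := Multiset.mem_of_le h2 (Multiset.mem_map_of_mem _ hp)
    have hpos : 1 ≤ (A ×ˢ B).count p :=
      Multiset.one_le_count_iff_mem.2 (Multiset.mem_product.2 ⟨hA, hB⟩)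
    have hc : M.card ≤ A.card := by simpa using Multiset.card_le_card h1
    have hm := Multiset.count_le_card p M
    rw [Multiset.count_nsmul]
    nlinarith
  · simp [Multiset.count_eq_zero_of_notMem hp]

theorem exists_cons_le_of_card_lt {α : Type*} (S A : Multiset α) (h : S ≤ A)
    (hc : S.card < A.card) : ∃ a ∈ A, a ::ₘ S ≤ A := by
  obtain ⟨a, ha⟩ := Multiset.lt_iff_cons_le.1 (lt_of_le_of_ne h (by rintro rfl; omega))
  exact ⟨a, Multiset.mem_of_le ha (Multiset.mem_cons_self _ _), ha⟩

theorem exists_complete_le {α : Type*} [MetricSpace α] (ρ : ℝ)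
    (A B : Multiset α) (h : ∀ x ∈ A, ∀ y ∈ B, dist x y ≤ 2 * ρ) (n : ℕ) :
    ∀ M : Multiset (α × α), IsMatching A B M → min A.card B.card = M.card + n →
    ∃ N : Multiset (α × α), IsMatching A B N ∧ N.card = min A.card B.card ∧
      fpMatchingCost ρ A B N ≤ fpMatchingCost ρ A B M := by
  induction n with
  | zero => exact fun M hM hc => ⟨M, hM, by omega, le_rfl⟩
  | succ n ih =>
    intro M hM hc
    obtain ⟨a, ha, ha'⟩ := exists_cons_le_of_card_lt _ _ hM.1 (by rw [Multiset.card_map]; omega)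
    obtain ⟨b, hb, hb'⟩ := exists_cons_le_of_card_lt _ _ hM.2 (by rw [Multiset.card_map]; omega)
    obtain ⟨N, hN, hNc, hle⟩ := ih ((a, b) ::ₘ M) ⟨by simpa using ha', by simpa using hb'⟩
      (by rw [Multiset.card_cons]; omega)
    refine ⟨N, hN, hNc, hle.trans ?_⟩
    have := h a ha b hb
    simp only [fpMatchingCost, Multiset.map_cons, Multiset.sum_cons, Multiset.card_cons]
    push_cast
    linarith

/-- For the fixed-penalty matching distance, if `ρ ≥ (1/2) · max_{x ∈ A, y ∈ B} d(x,y)`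
(i.e. `d(x,y) ≤ 2ρ` for all `x ∈ A`, `y ∈ B`), then there exists a complete matching
(one of size `min |A| |B|`) achieving the minimum. -/
theorem dFPMatch_exists_complete {α : Type*} [MetricSpace α] (ρ : ℝ) (hρ : 0 < ρ)
    (A B : Multiset α) (h : ∀ x ∈ A, ∀ y ∈ B, dist x y ≤ 2 * ρ) :
    ∃ M : Multiset (α × α), IsMatching A B M ∧ M.card = min A.card B.card ∧
      fpMatchingCost ρ A B M = dFPMatch ρ A B := by
  obtain ⟨M, hM, hmin⟩ := Set.exists_min_image _ (fpMatchingCost ρ A B) (isMatching_finite A B)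
    ⟨0, by simp [IsMatching]⟩
  have hM' : IsMatching A B M := hM
  have h1 : M.card ≤ A.card := by simpa using Multiset.card_le_card hM'.1
  have h2 : M.card ≤ B.card := by simpa using Multiset.card_le_card hM'.2
  obtain ⟨N, hN, hNc, hle⟩ := exists_complete_le ρ A B h (min A.card B.card - M.card) M hM'
    (by omega)
  refine ⟨N, hN, hNc, ?_⟩
  have : IsLeast {c | ∃ M, IsMatching A B M ∧ c = fpMatchingCost ρ A B M}
      (fpMatchingCost ρ A B N) := by
    refine ⟨⟨N, hN, rfl⟩, ?_⟩
    rintro c ⟨K, hK, rfl⟩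
    exact hle.trans (hmin K hK)
  exact this.csInf_eq.symm
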